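/- Let T̂ be the reference tetrahedron with vertices (1,1,1), (1,−1,−1), (−1,1,−1), (−1,−1,1), with edges E₁,…,E₆, unit tangent vectors t_{E₁},…,t_{E₆} (a unit vector along each edge), and associated Lagrange basis functions φ_{E₁},…,φ_{E₆}. Given a ∈ ℝ and b ∈ ℝ³, let q(x) = a + b·x and define the polynomial vector field v*(x) = −Σᵢ₌₁⁶ (t_{Eᵢ}·b) t_{Eᵢ} φ_{Eᵢ}(x). Then ∫_{T̂} (∇·v*)(x) q(x) dλ(x) = (8/45) Σᵢ₌₁⁶ (t_{Eᵢ}·b)². -/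

import Mathlib

open MeasureTheory

noncomputable section

/-- The vertices of the reference tetrahedron `T̂`. -/
def tverts : Fin 4 → (Fin 3 → ℝ) :=
  ![![1,1,1], ![1,-1,-1], ![-1,1,-1], ![-1,-1,1]]

/-- An enumeration of the six edges of `T̂` by their pairs of vertex indices. -/
def edges : Fin 6 → Fin 4 × Fin 4 :=
  ![(0,1), (2,3), (0,2), (1,3), (0,3), (1,2)]

/-- The reference tetrahedron `T̂`. -/
def Tref : Set (Fin 3 → ℝ) := convexHull ℝ (Set.range tverts)

/-- The rotated `Q₁` space `V(K̂) = span(1, x₁, x₂, x₃, x₁²-x₂², x₂²-x₃²)`. -/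
def VK : Submodule ℝ ((Fin 3 → ℝ) → ℝ) :=
  Submodule.span ℝ
    (Set.range
      (![fun _ => 1, fun x => x 0, fun x => x 1, fun x => x 2,
        fun x => x 0 ^ 2 - x 1 ^ 2, fun x => x 1 ^ 2 - x 2 ^ 2] :
        Fin 6 → ((Fin 3 → ℝ) → ℝ)))

theorem mem_Tref_iff (x : Fin 3 → ℝ) :
    x ∈ Tref ↔ |x 0 + x 1| ≤ 1 + x 2 ∧ |x 0 - x 1| ≤ 1 - x 2 := by
  simp only [abs_le]
  constructor
  · intro hx
    have hconv : Convex ℝ {x : Fin 3 → ℝ | (-(1 + x 2) ≤ x 0 + x 1 ∧ x 0 + x 1 ≤ 1 + x 2) ∧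
        (-(1 - x 2) ≤ x 0 - x 1 ∧ x 0 - x 1 ≤ 1 - x 2)} := by
      rintro x ⟨⟨h1, h2⟩, h3, h4⟩ y ⟨⟨k1, k2⟩, k3, k4⟩ s r hs hr hsr
      obtain rfl : r = 1 - s := by linarith
      simp only [Set.mem_ofPred_eq, Pi.add_apply, Pi.smul_apply, smul_eq_mul]
      refine ⟨⟨?_, ?_⟩, ?_, ?_⟩ <;> nlinarith
    refine convexHull_min ?_ hconv hx
    rintro _ ⟨i, rfl⟩
    fin_cases i <;> simp [tverts] <;> norm_num
  · rintro ⟨⟨h1, h2⟩, h3, h4⟩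
    have hmem := (convex_convexHull ℝ (Set.range tverts)).sum_mem (t := Finset.univ)
      (w := ![(1 + x 0 + x 1 + x 2) / 4, (1 + x 0 - x 1 - x 2) / 4,
        (1 - x 0 + x 1 - x 2) / 4, (1 - x 0 - x 1 + x 2) / 4]) (z := tverts)
      (by intro i _; fin_cases i <;> simp <;> linarith)
      (by simp [Fin.sum_univ_four]; ring)
      (fun i _ => subset_convexHull ℝ _ ⟨i, rfl⟩)
    have hx : x = ∑ i, ![(1 + x 0 + x 1 + x 2) / 4, (1 + x 0 - x 1 - x 2) / 4,
        (1 - x 0 + x 1 - x 2) / 4, (1 - x 0 - x 1 + x 2) / 4] i • tverts i := by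
      ext m
      fin_cases m <;> simp [Fin.sum_univ_four, tverts] <;> ring
    rw [hx]
    exact hmem

/-- The linear chart `(z, u, v) ↦ ((u + v) / 2, (u - v) / 2, z)`, in which the horizontal slices of
`Tref` are coordinate rectangles. -/
def sliceMatrix : Matrix (Fin 3) (Fin 3) ℝ :=
  !![0, 1 / 2, 1 / 2; 0, 1 / 2, -(1 / 2); 1, 0, 0]

theorem det_sliceMatrix : sliceMatrix.det = -(1 / 2) := by
  simp [sliceMatrix, Matrix.det_fin_three]
  norm_num

theorem setIntegral_Tref_eq_slice (f : (Fin 3 → ℝ) → ℝ) :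
    ∫ x in Tref, f x = 1 / 2 * ∫ p in {p : ℝ × ℝ × ℝ | |p.2.1| ≤ 1 + p.1 ∧ |p.2.2| ≤ 1 - p.1},
      f ![(p.2.1 + p.2.2) / 2, (p.2.1 - p.2.2) / 2, p.1] := by
  set L : (Fin 3 → ℝ) →L[ℝ] (Fin 3 → ℝ) := (Matrix.toLin' sliceMatrix).toContinuousLinearMap
  have hL (y : Fin 3 → ℝ) : L y = ![(y 1 + y 2) / 2, (y 1 - y 2) / 2, y 0] := by
    ext m
    fin_cases m <;>
      simp [L, sliceMatrix, Matrix.mulVec, dotProduct, Fin.sum_univ_three] <;> ring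
  have hdet : L.det = -(1 / 2) := by
    rw [← det_sliceMatrix, ← LinearMap.det_toLin']
    rfl
  set S : Set (Fin 3 → ℝ) := {y | |y 1| ≤ 1 + y 0 ∧ |y 2| ≤ 1 - y 0}
  have hS : MeasurableSet S := by
    have h1 : IsClosed {y : Fin 3 → ℝ | |y 1| ≤ 1 + y 0} :=
      isClosed_le (by fun_prop) (by fun_prop)
    have h2 : IsClosed {y : Fin 3 → ℝ | |y 2| ≤ 1 - y 0} :=
      isClosed_le (by fun_prop) (by fun_prop)
    exact (h1.inter h2).measurableSet
  have himage : L '' S = Tref := by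
    ext x
    rw [mem_Tref_iff]
    constructor
    · rintro ⟨y, ⟨h1, h2⟩, rfl⟩
      rw [hL]
      simp only [Matrix.cons_val]
      ring_nf at h1 h2 ⊢
      exact ⟨h1, h2⟩
    · rintro ⟨h1, h2⟩
      refine ⟨![x 2, x 0 + x 1, x 0 - x 1], ⟨h1, h2⟩, ?_⟩
      rw [hL]
      ext m
      fin_cases m <;> simp
  have hinj : Set.InjOn L S := by
    intro y _ z _ h
    rw [hL, hL] at h
    have h0 := congrFun h 0
    have h1 := congrFun h 1
    have h2 := congrFun h 2
    simp only [Matrix.cons_val] at h0 h1 h2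
    ext m
    fin_cases m <;> simp only [Fin.zero_eta, Fin.mk_one, Fin.reduceFinMk] <;> linarith
  rw [← himage, integral_image_eq_integral_abs_det_fderiv_smul volume hS
    (fun x _ => L.hasFDerivAt.hasFDerivWithinAt) hinj, hdet]
  have hp := ((MeasurePreserving.id (volume : Measure ℝ)).prod
    (volume_preserving_finTwoArrow ℝ)).comp
      (volume_preserving_piFinSuccAbove (fun _ : Fin 3 => ℝ) 0)
  have he : MeasurableEmbedding (Prod.map id (MeasurableEquiv.finTwoArrow (α := ℝ)) ∘
      MeasurableEquiv.piFinSuccAbove (fun _ : Fin 3 => ℝ) 0) :=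
    (MeasurableEmbedding.id.prodMap (MeasurableEquiv.measurableEmbedding _)).comp
      (MeasurableEquiv.measurableEmbedding _)
  have := hp.setIntegral_preimage_emb he
    (fun p : ℝ × ℝ × ℝ => f ![(p.2.1 + p.2.2) / 2, (p.2.1 - p.2.2) / 2, p.1])
    {p : ℝ × ℝ × ℝ | |p.2.1| ≤ 1 + p.1 ∧ |p.2.2| ≤ 1 - p.1}
  have hvol : (volume : Measure (ℝ × ℝ × ℝ)) = volume.prod volume := rfl
  rw [hvol, ← this, ← integral_const_mul]
  have habs : |(-(1 / 2) : ℝ)| = 1 / 2 := by norm_num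
  simp only [hL, habs, smul_eq_mul]
  rfl

theorem integral_slice {f : ℝ × ℝ × ℝ → ℝ} (hf : Continuous f) :
    ∫ p in {p : ℝ × ℝ × ℝ | |p.2.1| ≤ 1 + p.1 ∧ |p.2.2| ≤ 1 - p.1}, f p =
      ∫ z in (-1)..1, ∫ u in (-(1 + z))..(1 + z), ∫ v in (-(1 - z))..(1 - z), f (z, u, v) := by
  set S : Set (ℝ × ℝ × ℝ) := {p | |p.2.1| ≤ 1 + p.1 ∧ |p.2.2| ≤ 1 - p.1}
  have hclosed : IsClosed S := by
    have h1 : IsClosed {p : ℝ × ℝ × ℝ | |p.2.1| ≤ 1 + p.1} :=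
      isClosed_le (by fun_prop) (by fun_prop)
    have h2 : IsClosed {p : ℝ × ℝ × ℝ | |p.2.2| ≤ 1 - p.1} :=
      isClosed_le (by fun_prop) (by fun_prop)
    exact h1.inter h2
  have hcompact : IsCompact S := by
    refine (isCompact_Icc (a := ((-1, -2, -2) : ℝ × ℝ × ℝ)) (b := (1, 2, 2))).of_isClosed_subset
      hclosed ?_
    rintro ⟨z, u, v⟩ ⟨h1, h2⟩
    simp only [abs_le] at h1 h2
    simp only [Set.mem_Icc, Prod.mk_le_mk]
    refine ⟨⟨?_, ?_, ?_⟩, ?_, ?_, ?_⟩ <;> linarith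
  have hint : Integrable (S.indicator f) :=
    (integrable_indicator_iff hclosed.measurableSet).2
      (hf.continuousOn.integrableOn_compact hcompact)
  rw [← integral_indicator hclosed.measurableSet, Measure.volume_eq_prod,
    integral_prod _ hint, intervalIntegral.integral_of_le (by norm_num),
    ← integral_Icc_eq_integral_Ioc, ← integral_indicator measurableSet_Icc]
  congr 1
  ext z
  by_cases hz : z ∈ Set.Icc (-1 : ℝ) 1
  · rw [Set.indicator_of_mem hz]
    obtain ⟨hz1, hz2⟩ := hz
    have hslice : (fun q : ℝ × ℝ => S.indicator f (z, q)) =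
        (Set.Icc (-(1 + z)) (1 + z) ×ˢ Set.Icc (-(1 - z)) (1 - z)).indicator
          (fun q => f (z, q)) := by
      ext q
      simp only [Set.indicator, S, Set.mem_ofPred_eq, Set.mem_prod, Set.mem_Icc, abs_le]
    rw [hslice, integral_indicator (measurableSet_Icc.prod measurableSet_Icc),
      Measure.volume_eq_prod, setIntegral_prod,
      intervalIntegral.integral_of_le (by linarith), ← integral_Icc_eq_integral_Ioc]
    · congr 1
      ext u
      rw [intervalIntegral.integral_of_le (by linarith), ← integral_Icc_eq_integral_Ioc]
    · exact ContinuousOn.integrableOn_compact (isCompact_Icc.prod isCompact_Icc) (by fun_prop)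
  · rw [Set.indicator_of_notMem hz]
    have hzero : (fun q : ℝ × ℝ => S.indicator f (z, q)) = 0 := by
      ext q
      refine Set.indicator_of_notMem (fun hq => hz ?_) _
      have h1 := (abs_nonneg _).trans hq.1
      have h2 := (abs_nonneg _).trans hq.2
      simp only at h1 h2
      constructor <;> linarith
    rw [hzero]
    simp

theorem integral_linear_mul_affine_Tref (a : ℝ) (b : Fin 3 → ℝ) :
    ∫ x in Tref, (∑ m, b m * x m) * (a + ∑ m, b m * x m) = 8 / 15 * ∑ m, b m ^ 2 := by
  have hquad (A B C r : ℝ) : ∫ v in (-r)..r, (A + B * v + C * v ^ 2) =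
      2 * A * r + 2 / 3 * C * r ^ 3 := by
    rw [intervalIntegral.integral_add, intervalIntegral.integral_add,
      intervalIntegral.integral_const_mul, intervalIntegral.integral_const_mul, integral_id,
      integral_pow, intervalIntegral.integral_const, smul_eq_mul]
    · ring
    all_goals exact Continuous.intervalIntegrable (by fun_prop) _ _
  rw [setIntegral_Tref_eq_slice, integral_slice]
  · simp only [Fin.sum_univ_three, Matrix.cons_val]
    set p := (b 0 + b 1) / 2 with hp
    set q := (b 0 - b 1) / 2 with hq
    have hv (z u : ℝ) : ∫ v in (-(1 - z))..(1 - z),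
        (b 0 * ((u + v) / 2) + b 1 * ((u - v) / 2) + b 2 * z) *
          (a + (b 0 * ((u + v) / 2) + b 1 * ((u - v) / 2) + b 2 * z)) =
        2 * (p * u + b 2 * z) * (a + (p * u + b 2 * z)) * (1 - z) +
          2 / 3 * q ^ 2 * (1 - z) ^ 3 := by
      have h := hquad ((p * u + b 2 * z) * (a + (p * u + b 2 * z)))
        (q * a + 2 * q * (p * u + b 2 * z)) (q ^ 2) (1 - z)
      rw [← mul_assoc] at h
      rw [← h]
      congr 1
      ext v
      rw [hp, hq]
      ring
    have hu (z : ℝ) : ∫ u in (-(1 + z))..(1 + z),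
        (2 * (p * u + b 2 * z) * (a + (p * u + b 2 * z)) * (1 - z) +
          2 / 3 * q ^ 2 * (1 - z) ^ 3) =
        2 * (2 * (b 2 * z) * (a + b 2 * z) * (1 - z) + 2 / 3 * q ^ 2 * (1 - z) ^ 3) * (1 + z) +
          2 / 3 * (2 * p ^ 2 * (1 - z)) * (1 + z) ^ 3 := by
      rw [← hquad _ (2 * (p * a + 2 * p * (b 2 * z)) * (1 - z))]
      congr 1
      ext u
      ring
    simp only [hv, hu]
    have hquartic (A B C D E : ℝ) :
        ∫ z in (-1)..1, (A + B * z + C * z ^ 2 + D * z ^ 3 + E * z ^ 4) =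
          2 * A + 2 / 3 * C + 2 / 5 * E := by
      rw [intervalIntegral.integral_add, intervalIntegral.integral_add,
        intervalIntegral.integral_add, intervalIntegral.integral_add]
      · rw [intervalIntegral.integral_const_mul B, integral_id]
        simp only [intervalIntegral.integral_const_mul, integral_pow,
          intervalIntegral.integral_const, smul_eq_mul]
        ring
      all_goals exact Continuous.intervalIntegrable (by fun_prop) _ _
    calc _ = 1 / 2 * ∫ z in (-1 : ℝ)..1, (4 / 3 * (p ^ 2 + q ^ 2) +
          (4 * b 2 * a + 8 / 3 * (p ^ 2 - q ^ 2)) * z + 4 * b 2 ^ 2 * z ^ 2 +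
          (-(4 * b 2 * a) - 8 / 3 * (p ^ 2 - q ^ 2)) * z ^ 3 +
          (-(4 * b 2 ^ 2) - 4 / 3 * (p ^ 2 + q ^ 2)) * z ^ 4) := by
            congr 2
            ext z
            ring
      _ = _ := by
        rw [hquartic, hp, hq]
        ring
  · simp only [Fin.sum_univ_three, Matrix.cons_val]
    fun_prop

/-- The partial derivatives of an element of `VK` in terms of its values at the edge midpoints. -/
theorem hasFDerivAt_of_mem_VK {f : (Fin 3 → ℝ) → ℝ} (hf : f ∈ VK) {w : Fin 6 → ℝ}
    (hval : ∀ j, f (midpoint ℝ (tverts (edges j).1) (tverts (edges j).2)) = w j)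
    (x : Fin 3 → ℝ) :
    HasFDerivAt f (∑ m, ![(w 0 - w 1) / 2 + (w 0 + w 1 - (∑ j, w j) / 3) * x 0,
      (w 2 - w 3) / 2 + (w 2 + w 3 - (∑ j, w j) / 3) * x 1,
      (w 4 - w 5) / 2 + (w 4 + w 5 - (∑ j, w j) / 3) * x 2] m •
        ContinuousLinearMap.proj (R := ℝ) (φ := fun _ : Fin 3 => ℝ) m) x := by
  obtain ⟨c, rfl⟩ := (Submodule.mem_span_range_iff_exists_fun ℝ).1 hf
  have h0 := hval 0
  have h1 := hval 1
  have h2 := hval 2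
  have h3 := hval 3
  have h4 := hval 4
  have h5 := hval 5
  simp [Fin.sum_univ_six, midpoint_eq_smul_add, tverts, edges] at h0 h1 h2 h3 h4 h5
  norm_num at h0 h1 h2 h3 h4 h5
  have hx (m : Fin 3) := hasFDerivAt_apply (𝕜 := ℝ) (F' := fun _ : Fin 3 => ℝ) m x
  have hsq (m : Fin 3) := (hx m).fun_mul (hx m)
  have hsum := (((((hasFDerivAt_const (c 0) x).fun_add ((hx 0).const_mul (c 1))).fun_add
    ((hx 1).const_mul (c 2))).fun_add ((hx 2).const_mul (c 3))).fun_add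
      (((hsq 0).fun_sub (hsq 1)).const_mul (c 4))).fun_add
        (((hsq 1).fun_sub (hsq 2)).const_mul (c 5))
  refine (hsum.congr_fderiv ?_).congr_of_eventuallyEq (Filter.Eventually.of_forall fun y => ?_)
  · ext y
    simp [Fin.sum_univ_three, Fin.sum_univ_six, ← h0, ← h1, ← h2, ← h3, ← h4, ← h5]
    ring
  · simp [Fin.sum_univ_six, sq]

theorem mul_eq_of_unit_tangent {t : Fin 3 → ℝ} (ht_unit : ∑ m, t m ^ 2 = 1) {i : Fin 6}
    (ht_dir : ∃ c : ℝ, t = c • (tverts (edges i).1 - tverts (edges i).2)) (m n : Fin 3) :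
    t m * t n = 1 / 8 * ((tverts (edges i).1 - tverts (edges i).2) m *
      (tverts (edges i).1 - tverts (edges i).2) n) := by
  obtain ⟨c, rfl⟩ := ht_dir
  have hnorm : ∑ m, (tverts (edges i).1 - tverts (edges i).2) m ^ 2 = 8 := by
    fin_cases i <;> simp [Fin.sum_univ_three, tverts, edges] <;> norm_num
  have hc : c ^ 2 = 1 / 8 := by
    simp only [Pi.smul_apply, smul_eq_mul, mul_pow, ← Finset.mul_sum, hnorm] at ht_unit
    linarith
  simp only [Pi.smul_apply, smul_eq_mul, ← hc]
  ring

/-- For unit tangents `t_{Eᵢ}` along the six edges of `T̂`, the Lagrange basis functions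
`φ_{Eᵢ}` of the rotated `Q₁` element, an affine function `q(x) = a + b·x`, and
`v*(x) = −Σᵢ (t_{Eᵢ}·b) t_{Eᵢ} φ_{Eᵢ}(x)`, one has
`∫_{T̂} (∇·v*) q dλ = (8/45) Σᵢ (t_{Eᵢ}·b)²`. -/
theorem divergence_identity_on_reference_tet (t : Fin 6 → (Fin 3 → ℝ))
    (ht_unit : ∀ i, ∑ m, t i m ^ 2 = 1)
    (ht_dir : ∀ i, ∃ c : ℝ, t i = c • (tverts (edges i).1 - tverts (edges i).2))
    (φ : Fin 6 → (Fin 3 → ℝ) → ℝ) (hφ : ∀ i, φ i ∈ VK)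
    (hval : ∀ i j,
      φ i (midpoint ℝ (tverts (edges j).1) (tverts (edges j).2)) =
        if i = j then 1 else 0)
    (a : ℝ) (b : Fin 3 → ℝ) :
    (∫ x in Tref,
        (∑ j, fderiv ℝ
            (fun y => -(∑ i, ((∑ m, t i m * b m) * t i j) * φ i y)) x (Pi.single j 1)) *
          (a + ∑ m, b m * x m) ∂volume)
      = 8 / 45 * ∑ i, (∑ m, t i m * b m) ^ 2 := by
  have hmul (i : Fin 6) (m n : Fin 3) := mul_eq_of_unit_tangent (ht_unit i) (ht_dir i) m n
  have hdiv (x : Fin 3 → ℝ) : ∑ j, fderiv ℝ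
      (fun y => -(∑ i, ((∑ m, t i m * b m) * t i j) * φ i y)) x (Pi.single j 1) =
        2 / 3 * ∑ m, b m * x m := by
    have hφ' (i : Fin 6) := hasFDerivAt_of_mem_VK (hφ i) (hval i) x
    have hfderiv (j : Fin 3) := (HasFDerivAt.fun_sum (u := Finset.univ) fun i _ =>
      (hφ' i).const_mul ((∑ m, t i m * b m) * t i j)).fun_neg.fderiv
    have hcoeff (i : Fin 6) (j : Fin 3) : (∑ m, t i m * b m) * t i j =
        1 / 8 * ((∑ m, (tverts (edges i).1 - tverts (edges i).2) m * b m) *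
          (tverts (edges i).1 - tverts (edges i).2) j) := by
      simp only [Fin.sum_univ_three]
      linear_combination b 0 * hmul i 0 j + b 1 * hmul i 1 j + b 2 * hmul i 2 j
    simp only [hfderiv]
    simp only [hcoeff]
    simp [Fin.sum_univ_three, Fin.sum_univ_six, tverts, edges]
    ring
  have hsq : ∑ i, (∑ m, t i m * b m) ^ 2 = 2 * ∑ m, b m ^ 2 := by
    have hterm (i : Fin 6) : (∑ m, t i m * b m) ^ 2 =
        1 / 8 * (∑ m, (tverts (edges i).1 - tverts (edges i).2) m * b m) ^ 2 := by
      rw [sq, sq, Finset.sum_mul_sum, Finset.sum_mul_sum, Finset.mul_sum]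
      refine Finset.sum_congr rfl fun m _ => ?_
      rw [Finset.mul_sum]
      refine Finset.sum_congr rfl fun n _ => ?_
      linear_combination b m * b n * hmul i m n
    simp only [hterm]
    simp [Fin.sum_univ_three, Fin.sum_univ_six, tverts, edges]
    ring
  simp only [hdiv, mul_assoc (2 / 3 : ℝ)]
  rw [integral_const_mul, integral_linear_mul_affine_Tref, hsq]
  ring

end
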